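/- For all a, b, c ∈ M one has (a·b)·c − a·(b·c) ∈ I; consequently the multiplication induced on the quotient A = M/I is associative. -/

import Mathlib

open scoped TensorProduct DirectSum

noncomputable section

/-- The pure tensor `a₀ ⊗ a₁ ⊗ ⋯ ⊗ a_{m-1}` in the `m`-th tensor power. -/
def tp (A : Type) [AddCommGroup A] [Module ℂ A] (m : ℕ) (a : ℕ → A) : ⨂[ℂ]^m A :=
  PiTensorProduct.tprod ℂ (fun i : Fin m => a i.1)

/-- The space `M = ⊕_{k=1}^{p} A₁^{⊗k}`; the component of index `k : Fin p` is the
tensor power of degree `k + 1`. -/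
abbrev Mspace (p : ℕ) (A : Type) [AddCommGroup A] [Module ℂ A] : Type :=
  ⨁ k : Fin p, ⨂[ℂ]^(k.1 + 1) A

/-- Inclusion of the degree-`(k+1)` homogeneous component into `M`. -/
def incl (p : ℕ) (A : Type) [AddCommGroup A] [Module ℂ A] (k : Fin p) :
    (⨂[ℂ]^(k.1 + 1) A) →ₗ[ℂ] Mspace p A :=
  DirectSum.lof ℂ (Fin p) (fun k : Fin p => ⨂[ℂ]^(k.1 + 1) A) k

/-- The one-step substitution `id^{⊗r} ⊗ Γ ⊗ id^{⊗(n-2-r)}` followed by `Γ`, evaluated on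
a family of `2n−3` arguments; used to state the general associativity condition. -/
def gammaIns (n : ℕ) (A : Type) [AddCommGroup A] [Module ℂ A]
    (Γ : MultilinearMap ℂ (fun _ : Fin (n - 1) => A) A) (r : ℕ) (a : ℕ → A) : A :=
  Γ (fun i : Fin (n - 1) =>
    if i.1 < r then a i.1
    else if i.1 = r then Γ (fun j : Fin (n - 1) => a (r + j.1))
    else a (i.1 + (n - 2)))

/-- `mul` is the bilinear multiplication of `M = ⊕_{k=1}^{p} A₁^{⊗k}` determined on
homogeneous pure tensors `a = a₁⊗⋯⊗a_k`, `b = b₁⊗⋯⊗b_l` by: `a·b = a ⊗ b` if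
`k + l ≤ p`, and `a·b = Γ(a₁,…,a_k,b₁,…,b_{p+1−k}) ⊗ b_{p+2−k} ⊗ ⋯ ⊗ b_l` if
`k + l > p`. -/
def MulSpec (n p : ℕ) (A : Type) [AddCommGroup A] [Module ℂ A]
    (Γ : MultilinearMap ℂ (fun _ : Fin (n - 1) => A) A)
    (mul : Mspace p A →ₗ[ℂ] Mspace p A →ₗ[ℂ] Mspace p A) : Prop :=
  ∀ (k l : Fin p) (a b : ℕ → A),
    mul (incl p A k (tp A (k.1 + 1) a)) (incl p A l (tp A (l.1 + 1) b)) =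
      if h : (k.1 + 1) + (l.1 + 1) ≤ p then
        incl p A ⟨k.1 + l.1 + 1, by omega⟩
          (tp A (k.1 + l.1 + 1 + 1)
            (fun i => if i < k.1 + 1 then a i else b (i - (k.1 + 1))))
      else
        incl p A ⟨k.1 + l.1 + 1 - p, by have := k.isLt; have := l.isLt; omega⟩
          (tp A (k.1 + l.1 + 1 - p + 1)
            (fun i =>
              if i = 0 then
                Γ (fun j : Fin (n - 1) =>
                  if j.1 < k.1 + 1 then a j.1 else b (j.1 - (k.1 + 1)))
              else b (p - (k.1 + 1) + i)))

/-- The subspace `I_k ⊆ A₁^{⊗k}`: `I₁ = {0}`, and for `2 ≤ k ≤ p`,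
`I_k = {a : a·b = 0 for all b ∈ A₁^{⊗(p+1−k)}}`.  (The component of index `k : Fin p`
has degree `k + 1`.) -/
def Ik (p : ℕ) (A : Type) [AddCommGroup A] [Module ℂ A]
    (mul : Mspace p A →ₗ[ℂ] Mspace p A →ₗ[ℂ] Mspace p A) (k : Fin p) :
    Submodule ℂ (⨂[ℂ]^(k.1 + 1) A) :=
  if k.1 = 0 then ⊥
  else
    ⨅ y : ⨂[ℂ]^(p - (k.1 + 1) + 1) A,
      LinearMap.ker
        ((mul.flip (incl p A ⟨p - (k.1 + 1), by have := k.isLt; omega⟩ y)).comp (incl p A k))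

/-- The subspace `I = ⊕_{k=1}^{p} I_k ⊆ M`. -/
def Isub (p : ℕ) (A : Type) [AddCommGroup A] [Module ℂ A]
    (mul : Mspace p A →ₗ[ℂ] Mspace p A →ₗ[ℂ] Mspace p A) : Submodule ℂ (Mspace p A) :=
  ⨆ k : Fin p, (Ik p A mul k).map (incl p A k)

/-- `qM` is the bilinear form on `M` determined on homogeneous pure tensors
`a ∈ A₁^{⊗k}`, `b ∈ A₁^{⊗l}` by: `q(a,b) = 0` if `k + l ≢ 2 mod p`;
`q(a,b) = q₁(a₁, Γ(a₂,…,a_k,b₁,…,b_l))` if `k + l = n`; and `q(a,b) = q₁(a₁,b₁)` if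
`k = l = 1`. -/
def QSpec (n p : ℕ) (A : Type) [AddCommGroup A] [Module ℂ A]
    (Γ : MultilinearMap ℂ (fun _ : Fin (n - 1) => A) A)
    (q₁ : A →ₗ[ℂ] A →ₗ[ℂ] ℂ)
    (qM : Mspace p A →ₗ[ℂ] Mspace p A →ₗ[ℂ] ℂ) : Prop :=
  ∀ (k l : Fin p) (a b : ℕ → A),
    qM (incl p A k (tp A (k.1 + 1) a)) (incl p A l (tp A (l.1 + 1) b)) =
      if ((k.1 + 1) + (l.1 + 1)) % p = 2 % p then
        (if (k.1 + 1) + (l.1 + 1) = n then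
          q₁ (a 0) (Γ (fun j : Fin (n - 1) =>
            if j.1 + 1 < k.1 + 1 then a (j.1 + 1) else b (j.1 + 1 - (k.1 + 1))))
        else q₁ (a 0) (b 0))
      else 0

/-- Homogeneous pure tensor with natural-number index. -/
def EE (p : ℕ) (A : Type) [AddCommGroup A] [Module ℂ A] (k : ℕ) (a : ℕ → A) : Mspace p A :=
  if h : k < p then incl p A ⟨k, h⟩ (tp A (k + 1) a) else 0

/-- Concatenation of words. -/
def catw {A : Type} (k : ℕ) (a b : ℕ → A) : ℕ → A :=
  fun i => if i < k then a i else b (i - k)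

/-- Apply `G` to `p+1` consecutive letters, starting at position `r`. -/
def redAt {A : Type} (G : (ℕ → A) → A) (p r : ℕ) (w : ℕ → A) : ℕ → A :=
  fun i => if i < r then w i else if i = r then G (fun j => w (r + j)) else w (i + p)

theorem EE_congr (p : ℕ) (A : Type) [AddCommGroup A] [Module ℂ A] {k l : ℕ} {a b : ℕ → A}
    (hkl : k = l) (h : ∀ i, i ≤ k → a i = b i) : EE p A k a = EE p A l b := by
  subst hkl
  have : tp A (k + 1) a = tp A (k + 1) b := by
    unfold tp
    congr 1
    funext i
    exact h i.1 (by have := i.2; omega)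
  simp only [EE, this]

theorem Mspace_ind (p : ℕ) (A : Type) [AddCommGroup A] [Module ℂ A] (P : Mspace p A → Prop)
    (h0 : P 0) (hadd : ∀ x y, P x → P y → P (x + y)) (hsmul : ∀ (r : ℂ) x, P x → P (r • x))
    (hE : ∀ k a, k < p → P (EE p A k a)) (x : Mspace p A) : P x := by
  induction x using DirectSum.induction_on with
  | zero => exact h0
  | add x y hx hy => exact hadd x y hx hy
  | of k t =>
    change P (incl p A k t)
    induction t using PiTensorProduct.induction_on with
    | smul_tprod r f =>
      rw [map_smul]
      apply hsmul
      have h := hE k.1 (fun i => if h : i < k.1 + 1 then f ⟨i, h⟩ else 0) k.2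
      have e : tp A (k.1 + 1) (fun i => if h : i < k.1 + 1 then f ⟨i, h⟩ else 0)
          = PiTensorProduct.tprod ℂ f := by
        unfold tp
        congr 1
        funext i
        exact dif_pos i.2
      simp only [EE, k.2, dite_true] at h
      rw [e] at h
      exact h
    | add x y hx hy =>
      rw [map_add]
      exact hadd _ _ hx hy

theorem catw_assoc {A : Type} (k l : ℕ) (a b c : ℕ → A) :
    catw (k + l) (catw k a b) c = catw k a (catw l b c) := by
  funext i
  simp only [catw]
  by_cases h1 : i < k
  · have : i < k + l := by omega
    simp [h1, this]
  · by_cases h2 : i < k + l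
    · have : i - k < l := by omega
      simp [h1, h2, this]
    · have h3 : ¬ (i - k < l) := by omega
      have h4 : i - (k + l) = i - k - l := by omega
      simp [h1, h2, h3, h4]

theorem catw_red_left {A : Type} (G : (ℕ → A) → A) (p r d : ℕ)
    (hG : ∀ u v : ℕ → A, (∀ i, i ≤ p → u i = v i) → G u = G v)
    (hr : r < d) (w c : ℕ → A) :
    catw d (redAt G p r w) c = redAt G p r (catw (d + p) w c) := by
  funext i
  simp only [catw, redAt]
  by_cases h1 : i < r
  · have h2 : i < d := by omega
    have h3 : i < d + p := by omega
    simp [h1, h2, h3]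
  · by_cases h2 : i = r
    · subst h2
      simp only [hr, h1, if_true, if_false]
      apply hG
      intro j hj
      have : i + j < d + p := by omega
      simp [this]
    · by_cases h3 : i < d
      · simp [h1, h2, h3]
      · have h4 : i + p - (d + p) = i - d := by omega
        simp [h1, h2, h3, h4]

theorem catw_red_right {A : Type} (G : (ℕ → A) → A) (p k : ℕ) (a w : ℕ → A) :
    catw k a (redAt G p 0 w) = redAt G p k (catw k a w) := by
  funext i
  simp only [catw, redAt]
  by_cases h1 : i < k
  · simp [h1]
  · by_cases h2 : i = k
    · subst h2
      simp
    · have h3 : ¬ (i - k = 0) := by omega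
      have h4 : ¬ (i + p < k) := by omega
      have h5 : i + p - k = i - k + p := by omega
      simp [h1, h2, h3, h4, h5]

theorem redAt_redAt {A : Type} (G : (ℕ → A) → A) (p r : ℕ) (hr : r ≤ p) (w : ℕ → A)
    (hA : G (redAt G p 0 w) = G (redAt G p r w)) :
    redAt G p 0 (redAt G p 0 w) = redAt G p 0 (redAt G p r w) := by
  funext i
  by_cases h : i = 0
  · subst h
    have e : ∀ v : ℕ → A, redAt G p 0 v 0 = G v := by intro v; simp [redAt]
    rw [e, e]
    exact hA
  · have h1 : ¬ (i + p < r) := by omega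
    have h2 : ¬ (i + p = r) := by omega
    have h3 : ¬ (i + p = 0) := by omega
    have e : ∀ v : ℕ → A, redAt G p 0 v i = v (i + p) := by intro v; simp [redAt, h]
    rw [e, e]
    simp only [redAt, h1, h2, h3, if_false, not_lt_zero]

theorem mem_Isub (p : ℕ) (A : Type) [AddCommGroup A] [Module ℂ A]
    (mul : Mspace p A →ₗ[ℂ] Mspace p A →ₗ[ℂ] Mspace p A) (d : ℕ) (hd0 : 0 < d) (hd : d < p)
    (a b : ℕ → A)
    (h : ∀ y, mul (EE p A d a) (EE p A (p - (d + 1)) y)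
      = mul (EE p A d b) (EE p A (p - (d + 1)) y)) :
    EE p A d a - EE p A d b ∈ Isub p A mul := by
  have hd' : p - (d + 1) < p := by omega
  unfold Isub
  apply Submodule.mem_iSup_of_mem (⟨d, hd⟩ : Fin p)
  refine ⟨tp A (d + 1) a - tp A (d + 1) b, ?_, ?_⟩
  · have hne : ¬ (d = 0) := by omega
    simp only [Ik, hne, if_false, SetLike.mem_coe, Submodule.mem_iInf, LinearMap.mem_ker,
      LinearMap.comp_apply, LinearMap.flip_apply]
    intro y
    induction y using PiTensorProduct.induction_on with
    | smul_tprod r f =>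
      have h1 := h (fun i => if h : i < p - (d + 1) + 1 then f ⟨i, h⟩ else 0)
      have e : tp A (p - (d + 1) + 1)
          (fun i => if h : i < p - (d + 1) + 1 then f ⟨i, h⟩ else 0)
          = PiTensorProduct.tprod ℂ f := by
        unfold tp
        congr 1
        funext i
        exact dif_pos i.2
      simp only [EE, hd, hd', dite_true] at h1
      rw [e] at h1
      rw [map_smul, map_smul, map_sub, map_sub, LinearMap.sub_apply, h1, sub_self, smul_zero]
    | add x y hx hy =>
      rw [map_add, map_add, hx, hy, add_zero]
  · simp only [EE, hd, dite_true, map_sub]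

theorem assoc_EE (p : ℕ) (A : Type) [AddCommGroup A] [Module ℂ A]
    (G : (ℕ → A) → A)
    (hG : ∀ u v : ℕ → A, (∀ i, i ≤ p → u i = v i) → G u = G v)
    (hA : ∀ r, r ≤ p → ∀ w, G (redAt G p 0 w) = G (redAt G p r w))
    (mul : Mspace p A →ₗ[ℂ] Mspace p A →ₗ[ℂ] Mspace p A)
    (h1 : ∀ k l, k < p → l < p → k + l + 2 ≤ p → ∀ a b,
      mul (EE p A k a) (EE p A l b) = EE p A (k + l + 1) (catw (k + 1) a b))
    (h2 : ∀ k l, k < p → l < p → ¬ (k + l + 2 ≤ p) → ∀ a b,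
      mul (EE p A k a) (EE p A l b) = EE p A (k + l + 1 - p) (redAt G p 0 (catw (k + 1) a b)))
    (k l m : ℕ) (hk : k < p) (hl : l < p) (hm : m < p) (a b c : ℕ → A) :
    mul (mul (EE p A k a) (EE p A l b)) (EE p A m c)
      - mul (EE p A k a) (mul (EE p A l b) (EE p A m c)) ∈ Isub p A mul := by
  have hW : catw (k + l + 1 + 1) (catw (k + 1) a b) c = catw (k + 1) a (catw (l + 1) b c) := by
    rw [← catw_assoc]
    congr 1
    omega
  -- the left bracketing
  have L1 : k + l + m + 3 ≤ p → mul (mul (EE p A k a) (EE p A l b)) (EE p A m c)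
      = EE p A (k + l + m + 2) (catw (k + 1) a (catw (l + 1) b c)) := by
    intro h
    rw [h1 k l hk hl (by omega), h1 _ m (by omega) hm (by omega), hW]
    exact EE_congr p A (by omega) (fun _ _ => rfl)
  have key : ¬ (k + l + 2 ≤ p) →
      catw (k + l + 1 - p + 1) (redAt G p 0 (catw (k + 1) a b)) c
        = redAt G p 0 (catw (k + 1) a (catw (l + 1) b c)) := by
    intro h
    rw [catw_red_left G p 0 _ hG (by omega), ← hW]
    congr 2
    omega
  have L2 : ¬ (k + l + m + 3 ≤ p) → k + l + m + 3 ≤ 2 * p →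
      mul (mul (EE p A k a) (EE p A l b)) (EE p A m c)
      = EE p A (k + l + m + 2 - p) (redAt G p 0 (catw (k + 1) a (catw (l + 1) b c))) := by
    intro h h'
    by_cases hkl : k + l + 2 ≤ p
    · rw [h1 k l hk hl hkl, h2 _ m (by omega) hm (by omega), hW]
      exact EE_congr p A (by omega) (fun _ _ => rfl)
    · rw [h2 k l hk hl hkl, h1 _ m (by omega) hm (by omega), key hkl]
      exact EE_congr p A (by omega) (fun _ _ => rfl)
  have L3 : ¬ (k + l + m + 3 ≤ 2 * p) →
      mul (mul (EE p A k a) (EE p A l b)) (EE p A m c)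
      = EE p A (k + l + m + 2 - p - p)
        (redAt G p 0 (redAt G p 0 (catw (k + 1) a (catw (l + 1) b c)))) := by
    intro h
    have hkl : ¬ (k + l + 2 ≤ p) := by omega
    rw [h2 k l hk hl hkl, h2 _ m (by omega) hm (by omega), key hkl]
    exact EE_congr p A (by omega) (fun _ _ => rfl)
  by_cases hlm : l + m + 2 ≤ p
  · rw [h1 l m hl hm hlm]
    by_cases h : k + l + m + 3 ≤ p
    · rw [L1 h, h1 k _ hk (by omega) (by omega),
        EE_congr p A (show k + (l + m + 1) + 1 = k + l + m + 2 by omega) (fun _ _ => rfl), sub_self]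
      exact Submodule.zero_mem _
    · rw [L2 h (by omega), h2 k _ hk (by omega) (by omega),
        EE_congr p A (show k + (l + m + 1) + 1 - p = k + l + m + 2 - p by omega)
          (fun _ _ => rfl), sub_self]
      exact Submodule.zero_mem _
  · rw [h2 l m hl hm hlm]
    by_cases h : k + l + m + 3 ≤ 2 * p
    · rw [L2 (by omega) h, h1 k _ hk (by omega) (by omega), catw_red_right,
        EE_congr p A (show k + (l + m + 1 - p) + 1 = k + l + m + 2 - p by omega) (fun _ _ => rfl)]
      apply mem_Isub p A mul _ (by omega) (by omega)
      intro y
      rw [h2 _ _ (by omega) (by omega) (by omega), h2 _ _ (by omega) (by omega) (by omega),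
        catw_red_left G p 0 _ hG (by omega), catw_red_left G p (k + 1) _ hG (by omega)]
      apply EE_congr p A rfl
      intro i hi
      rw [redAt_redAt G p (k + 1) (by omega) _ (hA _ (by omega) _)]
    · rw [L3 h, h2 k _ hk (by omega) (by omega), catw_red_right,
        redAt_redAt G p (k + 1) (by omega) _ (hA _ (by omega) _),
        EE_congr p A (show k + (l + m + 1 - p) + 1 - p = k + l + m + 2 - p - p by omega)
          (fun _ _ => rfl), sub_self]
      exact Submodule.zero_mem _

/-- For all `a, b, c ∈ M` one has `(a·b)·c − a·(b·c) ∈ I`; consequently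
the multiplication induced on the quotient `A = M/I` is associative. -/
theorem associator_mem_Isub_and_quotient_assoc
    (n p : ℕ) (hn : 3 ≤ n) (hp : p = n - 2)
    (A : Type) [AddCommGroup A] [Module ℂ A] [FiniteDimensional ℂ A]
    (Γ : MultilinearMap ℂ (fun _ : Fin (n - 1) => A) A)
    (q₁ : A →ₗ[ℂ] A →ₗ[ℂ] ℂ)
    (hq₁symm : ∀ x y : A, q₁ x y = q₁ y x)
    (hq₁nondeg : ∀ x : A, (∀ y : A, q₁ x y = 0) → x = 0)
    (hinv : ∀ a : ℕ → A,
      q₁ (Γ (fun i : Fin (n - 1) => a i.1)) (a (n - 1)) =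
        q₁ (a 0) (Γ (fun i : Fin (n - 1) => a (i.1 + 1))))
    (hassoc : ∀ r s : ℕ, r ≤ n - 2 → s ≤ n - 2 → ∀ a : ℕ → A,
      gammaIns n A Γ r a = gammaIns n A Γ s a)
    (mul : Mspace p A →ₗ[ℂ] Mspace p A →ₗ[ℂ] Mspace p A)
    (hmul : MulSpec n p A Γ mul)
    :
    (∀ a b c : Mspace p A,
      mul (mul a b) c - mul a (mul b c) ∈ Isub p A mul) ∧
    (∀ a b c : Mspace p A,
      (Isub p A mul).mkQ (mul (mul a b) c) = (Isub p A mul).mkQ (mul a (mul b c))) := by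
  have main : ∀ a b c : Mspace p A,
      mul (mul a b) c - mul a (mul b c) ∈ Isub p A mul := by
    set G : (ℕ → A) → A := fun w => Γ (fun j : Fin (n - 1) => w j.1) with hGdef
    have hG : ∀ u v : ℕ → A, (∀ i, i ≤ p → u i = v i) → G u = G v := by
      intro u v h
      simp only [hGdef]
      congr 1
      funext j
      exact h j.1 (by have := j.2; omega)
    have hA : ∀ r, r ≤ p → ∀ w, G (redAt G p 0 w) = G (redAt G p r w) := by
      intro r hr w
      have := hassoc 0 r (by omega) (by omega) w
      subst hp
      exact this
    have h1 : ∀ k l, k < p → l < p → k + l + 2 ≤ p → ∀ a b,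
        mul (EE p A k a) (EE p A l b) = EE p A (k + l + 1) (catw (k + 1) a b) := by
      intro k l hk hl h a b
      have := hmul ⟨k, hk⟩ ⟨l, hl⟩ a b
      rw [dif_pos (by simp only; omega)] at this
      simp only [EE, hk, hl, dite_true, show k + l + 1 < p by omega]
      exact this
    have h2 : ∀ k l, k < p → l < p → ¬ (k + l + 2 ≤ p) → ∀ a b,
        mul (EE p A k a) (EE p A l b)
          = EE p A (k + l + 1 - p) (redAt G p 0 (catw (k + 1) a b)) := by
      intro k l hk hl h a b
      have := hmul ⟨k, hk⟩ ⟨l, hl⟩ a b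
      rw [dif_neg (by simp only; omega)] at this
      have e : EE p A (k + l + 1 - p) (redAt G p 0 (catw (k + 1) a b))
          = EE p A (k + l + 1 - p) (fun i =>
              if i = 0 then
                Γ (fun j : Fin (n - 1) =>
                  if j.1 < k + 1 then a j.1 else b (j.1 - (k + 1)))
              else b (p - (k + 1) + i)) := by
        apply EE_congr p A rfl
        intro i hi
        by_cases h0 : i = 0
        · subst h0
          simp [redAt, hGdef, catw]
        · have h3 : ¬ (i + p < k + 1) := by omega
          have h4 : i + p - (k + 1) = p - (k + 1) + i := by omega
          simp [redAt, catw, h0, h3, h4]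
      rw [e]
      simp only [EE, hk, hl, dite_true, show k + l + 1 - p < p by omega]
      exact this
    intro a b c
    induction a using Mspace_ind with
    | h0 => simp
    | hadd x y hx hy =>
      have := Submodule.add_mem _ hx hy
      simp only [map_add, LinearMap.add_apply]
      convert this using 1
      abel
    | hsmul r x hx =>
      have := Submodule.smul_mem _ r hx
      simpa only [map_smul, LinearMap.smul_apply, smul_sub] using this
    | hE k a hk =>
    induction b using Mspace_ind with
    | h0 => simp
    | hadd x y hx hy =>
      have := Submodule.add_mem _ hx hy
      simp only [map_add, LinearMap.add_apply]
      convert this using 1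
      abel
    | hsmul r x hx =>
      have := Submodule.smul_mem _ r hx
      simpa only [map_smul, LinearMap.smul_apply, smul_sub] using this
    | hE l b hl =>
    induction c using Mspace_ind with
    | h0 => simp
    | hadd x y hx hy =>
      have := Submodule.add_mem _ hx hy
      simp only [map_add, LinearMap.add_apply]
      convert this using 1
      abel
    | hsmul r x hx =>
      have := Submodule.smul_mem _ r hx
      simpa only [map_smul, LinearMap.smul_apply, smul_sub] using this
    | hE m c hm => exact assoc_EE p A G hG hA mul h1 h2 k l m hk hl hm a b c
  refine ⟨main, fun a b c => ?_⟩
  rw [← sub_eq_zero, ← map_sub]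
  exact (Submodule.Quotient.mk_eq_zero _).2 (main a b c)
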